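/- arXiv:2009.06516 — 3 statements merged into one kernel-verified Lean document; each statement's English description precedes it below -/
import Mathlib

section
/- (Equivalence of enumeration and learning, maximum part.) Let n, m be natural numbers, let p : Fin m → ℝ satisfy 0 ≤ p i ≤ 1 for all i, and let ψ : (Fin n → Bool) → (Fin m → Bool) → Bool. For each σ₀ : Fin n → Bool let Φ_{σ₀} be the RE-SSAT instance with randomized quantifiers R^{p i} over the m inner variables followed by existential quantifiers over the n outer variables and matrix (σ, x) ↦ (ψ σ x ∧ σ = σ₀), and let Φ_ER be the ER-SSAT instance with existential quantifiers over the n outer variables followed by the same randomized quantifiers and matrix ψ. Then max over σ₀ : Fin n → Bool of val(Φ_{σ₀}) = val(Φ_ER). -/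
noncomputable section

/-- Value of a block of randomized quantifiers `R^{p 0}, …, R^{p (m-1)}`,
applied (outermost first) to the real-valued value function `g`:
`val(R^p b · Q, ψ) = p * val(Q, ψ[b:=true]) + (1-p) * val(Q, ψ[b:=false])`. -/
def rVal : (m : ℕ) → (Fin m → ℝ) → ((Fin m → Bool) → ℝ) → ℝ
  | 0, _, g => g (fun i => i.elim0)
  | m + 1, p, g =>
      p 0 * rVal m (fun i => p i.succ) (fun x => g (Fin.cons true x)) +
      (1 - p 0) * rVal m (fun i => p i.succ) (fun x => g (Fin.cons false x))

/-- Value of a block of existential quantifiers applied to `g`: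
`val(∃ b · Q, ψ) = max (val(Q, ψ[b:=true])) (val(Q, ψ[b:=false]))`. -/
def exVal : (n : ℕ) → ((Fin n → Bool) → ℝ) → ℝ
  | 0, g => g (fun i => i.elim0)
  | n + 1, g =>
      max (exVal n (fun σ => g (Fin.cons true σ)))
        (exVal n (fun σ => g (Fin.cons false σ)))

/-- Value of a block of universal quantifiers applied to `g`:
`val(∀ b · Q, ψ) = min (val(Q, ψ[b:=true])) (val(Q, ψ[b:=false]))`. -/
def allVal : (n : ℕ) → ((Fin n → Bool) → ℝ) → ℝ
  | 0, g => g (fun i => i.elim0)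
  | n + 1, g =>
      min (allVal n (fun σ => g (Fin.cons true σ)))
        (allVal n (fun σ => g (Fin.cons false σ)))

/-- Product Bernoulli measure `μ_p` of a set `S` of assignments:
`μ_p(S) = ∑_{x ∈ S} ∏_i (if x i then p i else 1 - p i)`. -/
def mu (m : ℕ) (p : Fin m → ℝ) (S : Set (Fin m → Bool)) : ℝ :=
  ∑ x : Fin m → Bool,
    Set.indicator S (fun y => ∏ i, (if y i then p i else 1 - p i)) x

theorem le_exVal (n : ℕ) (g : (Fin n → Bool) → ℝ) (σ : Fin n → Bool) :
    g σ ≤ exVal n g := by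
  induction n with
  | zero => exact (congrArg g (Subsingleton.elim _ _)).le
  | succ n ih =>
    rw [← Fin.cons_self_tail σ]
    cases σ 0 with
    | true => exact le_max_of_le_left (ih (fun τ => g (Fin.cons true τ)) _)
    | false => exact le_max_of_le_right (ih (fun τ => g (Fin.cons false τ)) _)

theorem exVal_le {n : ℕ} {g : (Fin n → Bool) → ℝ} {c : ℝ} (h : ∀ σ, g σ ≤ c) :
    exVal n g ≤ c := by
  induction n with
  | zero => exact h _
  | succ n ih => exact max_le (ih fun _ => h _) (ih fun _ => h _)

theorem exVal_eq_sup' (n : ℕ) (g : (Fin n → Bool) → ℝ) :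
    exVal n g = Finset.univ.sup' Finset.univ_nonempty g :=
  le_antisymm (exVal_le fun σ => Finset.le_sup' g (Finset.mem_univ σ))
    (Finset.sup'_le _ _ fun σ _ => le_exVal n g σ)

/-- Restricting the existential block to a single assignment `σ₀` evaluates the matrix there. -/
theorem exVal_ite_and_eq {n : ℕ} (f : (Fin n → Bool) → Bool) (σ₀ : Fin n → Bool) :
    exVal n (fun σ => if f σ ∧ σ = σ₀ then (1 : ℝ) else 0) = if f σ₀ then 1 else 0 := by
  apply le_antisymm
  · refine exVal_le fun σ => ?_
    by_cases h : σ = σ₀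
    · simp [h]
    · simp only [h, and_false, if_false]
      split_ifs <;> norm_num
  · simpa using le_exVal n (fun σ => if f σ ∧ σ = σ₀ then (1 : ℝ) else 0) σ₀

/-- Equivalence of enumeration and learning (maximum part): the maximum over
`σ₀` of the values of the RE-SSAT instances `Φ_{σ₀}` (randomized quantifiers
over the inner variables, then existential quantifiers over the outer
variables, matrix `(σ, x) ↦ ψ σ x ∧ σ = σ₀`) equals the value of the ER-SSAT
instance `Φ_ER` (existential quantifiers over the outer variables, then the
same randomized quantifiers, matrix `ψ`). -/
theorem enum_eq_learn_max (n m : ℕ) (p : Fin m → ℝ)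
    (hp : ∀ i, 0 ≤ p i ∧ p i ≤ 1)
    (ψ : (Fin n → Bool) → (Fin m → Bool) → Bool) :
    Finset.univ.sup' Finset.univ_nonempty
        (fun σ₀ : Fin n → Bool =>
          rVal m p (fun x =>
            exVal n (fun σ => if ψ σ x ∧ σ = σ₀ then (1 : ℝ) else 0))) =
      exVal n (fun σ => rVal m p (fun x => if ψ σ x then (1 : ℝ) else 0)) := by
  simp only [exVal_ite_and_eq (fun σ => ψ σ _), exVal_eq_sup' n (fun σ => rVal m p _)]
end
end

section
/- Let ε₀ ≥ 1 be a real number and n ≥ 1 a natural number. Then ∏_{i=1}^{n} (1 + (ln ε₀)/2^i) ≤ ε₀. -/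
theorem sum_Icc_div_two_pow (x : ℝ) (n : ℕ) :
    ∑ i ∈ Finset.Icc 1 n, x / 2 ^ i = x - x / 2 ^ n := by
  induction n with
  | zero => simp
  | succ n ih =>
    rw [Finset.sum_Icc_succ_top (by lia), ih, pow_succ]
    field_simp
    ring

/-- For a real `ε₀ ≥ 1` and `n ≥ 1`, `∏_{i=1}^{n} (1 + (ln ε₀) / 2^i) ≤ ε₀`. -/
theorem prod_one_add_log_div_pow_le (ε₀ : ℝ) (hε₀ : 1 ≤ ε₀) (n : ℕ) (hn : 1 ≤ n) :
    ∏ i ∈ Finset.Icc 1 n, (1 + Real.log ε₀ / 2 ^ i) ≤ ε₀ := by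
  have hlog : 0 ≤ Real.log ε₀ := Real.log_nonneg hε₀
  calc ∏ i ∈ Finset.Icc 1 n, (1 + Real.log ε₀ / 2 ^ i)
      ≤ ∏ i ∈ Finset.Icc 1 n, Real.exp (Real.log ε₀ / 2 ^ i) := by
        refine Finset.prod_le_prod (fun i _ => by positivity) fun i _ => ?_
        rw [add_comm]
        exact Real.add_one_le_exp _
    _ = Real.exp (Real.log ε₀ - Real.log ε₀ / 2 ^ n) := by
        rw [← Real.exp_sum, sum_Icc_div_two_pow]
    _ ≤ Real.exp (Real.log ε₀) := Real.exp_le_exp.2 (sub_le_self _ (by positivity))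
    _ = ε₀ := Real.exp_log (by linarith)
end

section
/- (Sample-complexity theorem, union-bound form.) Let (Ω, 𝔽, P) be a probability space, let m ≥ 1 be a natural number, δ ∈ (0,1), ε₀ ≥ 1 a real, p : Fin m → ℝ with p i ≥ 0 for all i, and ε : Fin m → ℝ with ε i ≥ 0 for all i and ∑_i ε i ≤ ln ε₀. Let p̂_i : Ω → ℝ be measurable random variables with p̂_i ≥ 0 everywhere, and suppose that for each i, P({ω | p̂_i(ω) > (1 + ε i) · p i}) ≤ δ/m. Then with probability at least 1 − δ, simultaneously for every family 𝒯 ⊆ Finset (Fin m) of subsets of Fin m, ∑_{T ∈ 𝒯} ∏_{i ∈ T} p̂_i(ω) ≤ ε₀ · ∑_{T ∈ 𝒯} ∏_{i ∈ T} p i. -/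
open MeasureTheory

theorem prod_one_add_le_of_sum_le_log {ι : Type*} [Fintype ι] {ε : ι → ℝ} {ε₀ : ℝ}
    (hε₀ : 0 < ε₀) (hε : ∀ i, 0 ≤ ε i) (hsum : ∑ i, ε i ≤ Real.log ε₀) (T : Finset ι) :
    ∏ i ∈ T, (1 + ε i) ≤ ε₀ :=
  calc ∏ i ∈ T, (1 + ε i)
      ≤ ∏ i ∈ T, Real.exp (ε i) :=
        Finset.prod_le_prod (fun i _ => by linarith [hε i])
          (fun i _ => by linarith [Real.add_one_le_exp (ε i)])
    _ = Real.exp (∑ i ∈ T, ε i) := (Real.exp_sum T ε).symm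
    _ ≤ Real.exp (Real.log ε₀) :=
        Real.exp_le_exp.2 ((Finset.sum_le_univ_sum_of_nonneg hε).trans hsum)
    _ = ε₀ := Real.exp_log hε₀

theorem sum_prod_le_mul_sum_prod {ι : Type*} [Fintype ι] {ε p q : ι → ℝ} {ε₀ : ℝ}
    (hε₀ : 0 < ε₀) (hε : ∀ i, 0 ≤ ε i) (hsum : ∑ i, ε i ≤ Real.log ε₀)
    (hp : ∀ i, 0 ≤ p i) (hq : ∀ i, 0 ≤ q i) (hqp : ∀ i, q i ≤ (1 + ε i) * p i)
    (𝒯 : Finset (Finset ι)) :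
    ∑ T ∈ 𝒯, ∏ i ∈ T, q i ≤ ε₀ * ∑ T ∈ 𝒯, ∏ i ∈ T, p i := by
  rw [Finset.mul_sum]
  refine Finset.sum_le_sum fun T _ => ?_
  calc ∏ i ∈ T, q i
      ≤ ∏ i ∈ T, (1 + ε i) * p i := Finset.prod_le_prod (fun i _ => hq i) (fun i _ => hqp i)
    _ = (∏ i ∈ T, (1 + ε i)) * ∏ i ∈ T, p i := Finset.prod_mul_distrib
    _ ≤ ε₀ * ∏ i ∈ T, p i :=
        mul_le_mul_of_nonneg_right (prod_one_add_le_of_sum_le_log hε₀ hε hsum T)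
          (Finset.prod_nonneg fun i _ => hp i)

/-- The union bound: if each of `m` measurable events has probability at most `δ / m`, then
with probability at least `1 - δ` none of them occurs. -/
theorem ofReal_one_sub_le_measure_compl_iUnion {Ω : Type*} [MeasurableSpace Ω]
    (P : Measure Ω) [IsProbabilityMeasure P] {m : ℕ} (hm : m ≠ 0) {δ : ℝ} (hδ : 0 ≤ δ)
    {B : Fin m → Set Ω} (hB : ∀ i, MeasurableSet (B i))
    (h : ∀ i, P (B i) ≤ ENNReal.ofReal (δ / m)) :
    ENNReal.ofReal (1 - δ) ≤ P (⋃ i, B i)ᶜ := by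
  have hunion : P (⋃ i, B i) ≤ ENNReal.ofReal δ :=
    calc P (⋃ i, B i) ≤ ∑ i, P (B i) := measure_iUnion_fintype_le P B
      _ ≤ ∑ _i : Fin m, ENNReal.ofReal (δ / m) := Finset.sum_le_sum fun i _ => h i
      _ = ENNReal.ofReal δ := by
        rw [← ENNReal.ofReal_sum_of_nonneg fun _ _ => by positivity]
        congr 1
        simp only [Finset.sum_const, Finset.card_univ, Fintype.card_fin, nsmul_eq_mul]
        field_simp
  rw [prob_compl_eq_one_sub (MeasurableSet.iUnion hB), ENNReal.ofReal_sub 1 hδ,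
    ENNReal.ofReal_one]
  exact tsub_le_tsub_left hunion 1

/-- Sample-complexity theorem, union-bound form: if each estimate `p̂ i`
exceeds `(1 + ε i) * p i` with probability at most `δ / m`, where the
nonnegative `ε i` satisfy `∑ i, ε i ≤ ln ε₀`, then with probability at least
`1 - δ`, simultaneously for every family `𝒯` of subsets of `Fin m`,
`∑_{T ∈ 𝒯} ∏_{i ∈ T} p̂ i ≤ ε₀ * ∑_{T ∈ 𝒯} ∏_{i ∈ T} p i`. -/
theorem sample_complexity_union_bound
    {Ω : Type*} [MeasurableSpace Ω] (P : Measure Ω) [IsProbabilityMeasure P]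
    (m : ℕ) (hm : 1 ≤ m) (δ : ℝ) (hδ0 : 0 < δ) (hδ1 : δ < 1)
    (ε₀ : ℝ) (hε₀ : 1 ≤ ε₀)
    (p : Fin m → ℝ) (hp : ∀ i, 0 ≤ p i)
    (ε : Fin m → ℝ) (hε : ∀ i, 0 ≤ ε i) (hsum : ∑ i, ε i ≤ Real.log ε₀)
    (phat : Fin m → Ω → ℝ) (hmeas : ∀ i, Measurable (phat i))
    (hnonneg : ∀ i ω, 0 ≤ phat i ω)
    (htail : ∀ i, P {ω | (1 + ε i) * p i < phat i ω} ≤ ENNReal.ofReal (δ / m)) :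
    ENNReal.ofReal (1 - δ) ≤
      P {ω | ∀ 𝒯 : Finset (Finset (Fin m)),
        ∑ T ∈ 𝒯, ∏ i ∈ T, phat i ω ≤ ε₀ * ∑ T ∈ 𝒯, ∏ i ∈ T, p i} := by
  refine (ofReal_one_sub_le_measure_compl_iUnion P (by omega) hδ0.le
    (fun i => measurableSet_lt measurable_const (hmeas i)) htail).trans
    (measure_mono fun ω hω 𝒯 => ?_)
  simp only [Set.mem_compl_iff, Set.mem_iUnion, Set.mem_ofPred_eq, not_exists, not_lt] at hω
  exact sum_prod_le_mul_sum_prod (by linarith) hε hsum hp (fun i => hnonneg i ω) hω 𝒯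
end
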